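/- Let G : ℂ⁺ → ℂ be an analytic function with Im G(z) ≤ 0 on ℂ⁺ (i.e. −G belongs to the Nevanlinna class of analytic maps ℂ⁺ → {Im w ≥ 0}), and suppose there exist real numbers m_0 = 1, m_1, …, m_{2n} such that (iy)^{2n+1} ( G(iy) − 1/(iy) − m_1/(iy)² − ⋯ − m_{2n−1}/(iy)^{2n} ) → m_{2n} as y → +∞. Then there exists a Borel probability measure μ on ℝ with ∫_ℝ u^k μ(du) = m_k for k = 0, 1, …, 2n such that G(z) = ∫_ℝ (z−u)^{-1} μ(du) for all z ∈ ℂ⁺. -/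

import Mathlib

open MeasureTheory Complex Filter Set
open scoped Topology

noncomputable section

namespace FreeCLT

def mom (μ : Measure ℝ) (k : ℕ) : ℝ := ∫ u, u ^ k ∂μ

def cauchy (μ : Measure ℝ) (z : ℂ) : ℂ := ∫ u, (z - (u : ℂ))⁻¹ ∂μ

def recip (μ : Measure ℝ) (z : ℂ) : ℂ := (cauchy μ z)⁻¹

def MemF (F : ℂ → ℂ) : Prop :=
  ∃ ν : Measure ℝ, IsProbabilityMeasure ν ∧ ∀ z : ℂ, 0 < z.im → F z = recip ν z

def Subord (μ : Measure ℝ) (n : ℕ) (Z : ℂ → ℂ) : Prop :=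
  MemF Z ∧ ∀ z : ℂ, 0 < z.im →
    z = (n : ℂ) * Z z - ((n : ℂ) - 1) * recip μ (Z z)

def IsBoxPow (μ : Measure ℝ) (n : ℕ) (Z : ℂ → ℂ) (ν : Measure ℝ) : Prop :=
  Subord μ n Z ∧ IsProbabilityMeasure ν ∧
    ∀ z : ℂ, 0 < z.im → recip ν z = recip μ (Z z)

def rescale (n : ℕ) (ν : Measure ℝ) : Measure ℝ :=
  ν.map (fun x => x / Real.sqrt n)

def HasDensity (ν : Measure ℝ) (p : ℝ → ℝ) : Prop :=
  Continuous p ∧ (∀ x, 0 ≤ p x) ∧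
    ν = MeasureTheory.volume.withDensity (fun x => ENNReal.ofReal (p x))

def aQ (μ : Measure ℝ) (n : ℕ) : ℝ := mom μ 3 / Real.sqrt n
def bQ (μ : Measure ℝ) (n : ℕ) : ℝ := (mom μ 4 - (mom μ 3) ^ 2 - 1) / n
def dQ (μ : Measure ℝ) (n : ℕ) : ℝ := (mom μ 4 - (mom μ 3) ^ 2) / n
def eQ (μ : Measure ℝ) (n : ℕ) : ℝ := (1 - bQ μ n) / Real.sqrt (1 - dQ μ n)

def pw (x : ℝ) : ℝ := (1 / (2 * Real.pi)) * Real.sqrt (max (4 - x ^ 2) 0)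

def truncSet (n : ℕ) : Set ℝ := {u : ℝ | |u| ≤ Real.sqrt ((n : ℝ) - 1) / Real.pi}

def Tfun (W : ℕ → ℂ → ℂ) (n : ℕ) (z : ℂ) : ℂ :=
  W n ((Real.sqrt (n : ℝ) : ℂ) * z) / (Real.sqrt (n : ℝ) : ℂ)

lemma ker_nonneg (y u : ℝ) : 0 ≤ y^2/(y^2+u^2) := by positivity
lemma ker_le (y u : ℝ) : y^2/(y^2+u^2) ≤ 1 := by
  apply div_le_one_of_le₀ <;> nlinarith [sq_nonneg y, sq_nonneg u]

lemma ker_meas (y : ℝ) : Measurable (fun u : ℝ => y^2/(y^2+u^2)) := by fun_prop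

lemma ker_tendsto (u : ℝ) : Tendsto (fun y : ℝ => y^2/(y^2+u^2)) atTop (𝓝 1) := by
  have h1 : Tendsto (fun y : ℝ => u^2/(y^2+u^2)) atTop (𝓝 0) := by
    apply Tendsto.div_atTop tendsto_const_nhds
    exact tendsto_atTop_add_const_right _ _ (tendsto_pow_atTop two_ne_zero)
  have h2 : Tendsto (fun y : ℝ => 1 - u^2/(y^2+u^2)) atTop (𝓝 1) := by
    simpa using (tendsto_const_nhds (x := (1:ℝ))).sub h1
  refine h2.congr' ?_
  filter_upwards [eventually_gt_atTop 0] with y hy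
  have : y^2+u^2 ≠ 0 := by positivity
  field_simp
  ring

lemma ker_dom (μ : Measure ℝ) (f : ℝ → ℝ) (hf : Integrable f μ) :
    Tendsto (fun y : ℝ => ∫ u, y^2/(y^2+u^2) * f u ∂μ) atTop (𝓝 (∫ u, f u ∂μ)) := by
  apply tendsto_integral_filter_of_dominated_convergence (fun u => ‖f u‖)
  · exact Eventually.of_forall fun y => (ker_meas y).aestronglyMeasurable.mul hf.1
  · refine Eventually.of_forall fun y => Eventually.of_forall fun u => ?_
    rw [norm_mul, Real.norm_of_nonneg (ker_nonneg y u)]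
    exact mul_le_of_le_one_left (norm_nonneg _) (ker_le y u)
  · exact hf.norm
  · refine Eventually.of_forall fun u => ?_
    simpa using (ker_tendsto u).mul_const (f u)

lemma ker_fatou (μ : Measure ℝ) (f : ℝ → ℝ) (h0 : ∀ u, 0 ≤ f u) (hm : Measurable f)
    (hint : ∀ y : ℝ, 0 < y → Integrable (fun u => y^2/(y^2+u^2) * f u) μ) (L : ℝ)
    (hL : Tendsto (fun y : ℝ => ∫ u, y^2/(y^2+u^2) * f u ∂μ) atTop (𝓝 L)) :
    Integrable f μ ∧ ∫ u, f u ∂μ = L := by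
  have hi : Integrable f μ := by
    have hn : Tendsto (fun n : ℕ => (n:ℝ) + 1) atTop atTop :=
      tendsto_atTop_add_const_right _ _ tendsto_natCast_atTop_atTop
    apply integrable_of_tendsto (G := fun n u => ((n:ℝ)+1)^2/(((n:ℝ)+1)^2+u^2) * f u)
    · refine Eventually.of_forall fun u => ?_
      simpa [Function.comp_def] using ((ker_tendsto u).mul_const (f u)).comp hn
    · intro n
      exact ((ker_meas _).mul hm).aestronglyMeasurable
    · have h1 : ∀ n : ℕ, ∫⁻ u, ‖((n:ℝ)+1)^2/(((n:ℝ)+1)^2+u^2) * f u‖ₑ ∂μ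
          = ENNReal.ofReal (∫ u, ((n:ℝ)+1)^2/(((n:ℝ)+1)^2+u^2) * f u ∂μ) := by
        intro n
        rw [ofReal_integral_eq_lintegral_ofReal (hint _ (by positivity))
          (Eventually.of_forall fun u => mul_nonneg (ker_nonneg _ _) (h0 u))]
        apply lintegral_congr
        intro u
        rw [Real.enorm_of_nonneg (mul_nonneg (ker_nonneg _ _) (h0 u))]
      simp_rw [h1]
      have h2 := (ENNReal.continuous_ofReal.tendsto L).comp (hL.comp hn)
      have h3 := h2.liminf_eq
      simp only [Function.comp_def] at h3
      rw [h3]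
      exact ENNReal.ofReal_ne_top
  exact ⟨hi, tendsto_nhds_unique (ker_dom μ f hi) hL⟩

lemma geom_id (z : ℂ) (u : ℂ) (hz : z ≠ 0) (hu : z - u ≠ 0) (N : ℕ) :
    (z-u)⁻¹ - ∑ k ∈ Finset.range N, u^k / z^(k+1) = u^N/(z^N*(z-u)) := by
  induction N with
  | zero => simp
  | succ N ih =>
    rw [Finset.sum_range_succ, ← sub_sub, ih]
    field_simp
    ring

lemma zsub_ne (z : ℂ) (hz : 0 < z.im) (u : ℝ) : z - u ≠ 0 := by
  intro h
  have := congrArg Complex.im h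
  simp at this
  linarith

lemma norm_inv_le (z : ℂ) (hz : 0 < z.im) (u : ℝ) : ‖(z - u)⁻¹‖ ≤ z.im⁻¹ := by
  rw [norm_inv]
  apply inv_anti₀ hz
  have := Complex.abs_im_le_norm (z - u)
  simp at this
  exact (le_abs_self _).trans this

lemma integrable_inv (μ : Measure ℝ) [IsFiniteMeasure μ] (z : ℂ) (hz : 0 < z.im) :
    Integrable (fun u : ℝ => (z - (u:ℂ))⁻¹) μ := by
  apply Integrable.of_bound (C := z.im⁻¹)
  · apply Measurable.aestronglyMeasurable; fun_prop
  · exact Eventually.of_forall (norm_inv_le z hz)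

lemma step_re (y u : ℝ) (hy : 0 < y) (K : ℕ) :
    ((I*y) * ((u:ℂ)^(K+1) / (I*y - u))).re = y^2/(y^2+u^2) * u^(K+1) := by
  have : (I*y) * ((u:ℂ)^(K+1) / (I*y - u)) = ((u^(K+1) : ℝ) : ℂ) * ((I*y) / (I*y-u)) := by
    push_cast; ring
  rw [this, Complex.re_ofReal_mul, Complex.div_re]
  have h : normSq (I*y-u) = y^2+u^2 := by simp [normSq_apply]; ring
  rw [h]
  simp
  field_simp

lemma step_im (y u : ℝ) (hy : 0 < y) (K : ℕ) :
    -(y * ((I*y) * ((u:ℂ)^(K+1) / (I*y - u))).im) = y^2/(y^2+u^2) * u^(K+2) := by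
  have : (I*y) * ((u:ℂ)^(K+1) / (I*y - u)) = ((u^(K+1) : ℝ) : ℂ) * ((I*y) / (I*y-u)) := by
    push_cast; ring
  rw [this, Complex.im_ofReal_mul, Complex.div_im]
  have h : normSq (I*y-u) = y^2+u^2 := by simp [normSq_apply]; ring
  rw [h]
  simp
  field_simp
  ring

lemma mom_step (μ : Measure ℝ) [IsProbabilityMeasure μ] (m : ℕ → ℝ) (K : ℕ) (hK : Even K)
    (hi : ∀ k ≤ K, Integrable (fun u : ℝ => u^k) μ) (hmom : ∀ k ≤ K, ∫ u, u^k ∂μ = m k)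
    (h1 : Tendsto (fun y : ℝ => (I * y) ^ (K + 2) * (cauchy μ (I * y)
            - ∑ k ∈ Finset.range (K+1), (m k : ℂ) / (I * y) ^ (k + 1))) atTop (𝓝 (m (K+1):ℂ)))
    (h2 : Tendsto (fun y : ℝ => (I * y) ^ (K + 3) * (cauchy μ (I * y)
            - ∑ k ∈ Finset.range (K+2), (m k : ℂ) / (I * y) ^ (k + 1))) atTop (𝓝 (m (K+2):ℂ))) :
    (Integrable (fun u : ℝ => u^(K+1)) μ ∧ ∫ u, u^(K+1) ∂μ = m (K+1)) ∧
    (Integrable (fun u : ℝ => u^(K+2)) μ ∧ ∫ u, u^(K+2) ∂μ = m (K+2)) := by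
  set X : ℝ → ℂ := fun y => (I * y) ^ (K + 2) * (cauchy μ (I * y)
            - ∑ k ∈ Finset.range (K+1), (m k : ℂ) / (I * y) ^ (k + 1)) with hX
  have hint : ∀ y : ℝ, 0 < y → Integrable (fun u : ℝ => (I*y) * ((u:ℂ)^(K+1) / (I*y - u))) μ ∧
      X y = ∫ u : ℝ, (I*y) * ((u:ℂ)^(K+1) / (I*y - u)) ∂μ := by
    intro y hy
    have hz : 0 < (I*(y:ℂ)).im := by simpa using hy
    have hz0 : I*(y:ℂ) ≠ 0 := by intro h; rw [h] at hz; simp at hz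
    have e : ∀ u : ℝ, (I*y) * ((u:ℂ)^(K+1) / (I*y - u)) = (I*y)^(K+2) *
        ((I*y-u)⁻¹ - ∑ k ∈ Finset.range (K+1), (u:ℂ)^k / (I*y)^(k+1)) := by
      intro u
      rw [geom_id _ _ hz0 (zsub_ne _ hz u)]
      have := zsub_ne _ hz u
      field_simp
      ring
    have hc : ∀ k ∈ Finset.range (K+1), Integrable (fun u : ℝ => (u:ℂ)^k / (I*y)^(k+1)) μ := by
      intro k hk
      have := (hi k (by simpa [Nat.lt_succ_iff] using hk)).ofReal (𝕜 := ℂ)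
      simpa using this.div_const ((I*(y:ℂ))^(k+1))
    have hs := integrable_finsetSum _ hc
    have hinv := integrable_inv μ _ hz
    simp_rw [e]
    refine ⟨(hinv.sub hs).const_mul _, ?_⟩
    rw [integral_const_mul, integral_sub hinv hs, integral_finsetSum _ hc]
    simp only [hX, cauchy]
    congr 2
    apply Finset.sum_congr rfl
    intro k hk
    rw [integral_div, ← hmom k (by simpa [Nat.lt_succ_iff] using hk), ← integral_complex_ofReal]
    simp
  have hre : ∀ y : ℝ, 0 < y → (X y).re = ∫ u, y^2/(y^2+u^2) * u^(K+1) ∂μ := by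
    intro y hy
    rw [(hint y hy).2]
    have := integral_re (hint y hy).1
    simp only [RCLike.re_eq_complex_re] at this
    rw [← this]
    exact integral_congr_ae (Eventually.of_forall fun u => step_re y u hy K)
  have him : ∀ y : ℝ, 0 < y → -(y * (X y).im) = ∫ u, y^2/(y^2+u^2) * u^(K+2) ∂μ := by
    intro y hy
    rw [(hint y hy).2]
    have := integral_im (hint y hy).1
    simp only [RCLike.im_eq_complex_im] at this
    rw [← this, ← integral_const_mul, ← integral_neg]
    exact integral_congr_ae (Eventually.of_forall fun u => step_im y u hy K)
  have iim : ∀ y : ℝ, 0 < y → Integrable (fun u : ℝ => y^2/(y^2+u^2) * u^(K+2)) μ := by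
    intro y hy
    have := (((hint y hy).1.im).const_mul y).neg
    refine this.congr (Eventually.of_forall fun u => ?_)
    simpa using step_im y u hy K
  have t2 : Tendsto (fun y : ℝ => ∫ u, y^2/(y^2+u^2) * u^(K+2) ∂μ) atTop (𝓝 (m (K+2))) := by
    have := (Complex.continuous_re.tendsto _).comp h2
    simp only [Function.comp_def, Complex.ofReal_re] at this
    refine this.congr' ?_
    filter_upwards [eventually_gt_atTop 0] with y hy
    rw [← him y hy]
    have hy0 : (y:ℂ) ≠ 0 := by exact_mod_cast hy.ne'
    have : (I * y) ^ (K + 3) * (cauchy μ (I * y)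
            - ∑ k ∈ Finset.range (K+2), (m k : ℂ) / (I * y) ^ (k + 1)) =
        (I*y) * (X y - m (K+1)) := by
      rw [Finset.sum_range_succ, ← sub_sub]
      simp only [hX]
      have : I * (y:ℂ) ≠ 0 := mul_ne_zero I_ne_zero hy0
      field_simp
      ring
    rw [this]
    simp
  have r2 := ker_fatou μ (fun u => u^(K+2)) (fun u => (hK.add even_two).pow_nonneg u)
    (by fun_prop) iim _ t2
  have i1 : Integrable (fun u : ℝ => u^(K+1)) μ := by
    refine Integrable.mono' ((integrable_const (1:ℝ)).add r2.1)
      (by apply Measurable.aestronglyMeasurable; fun_prop) (Eventually.of_forall fun u => ?_)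
    simp only [Pi.add_apply, norm_pow, Real.norm_eq_abs]
    have e : u^(K+2) = |u|^(K+2) := ((hK.add even_two).pow_abs u).symm
    rw [e]
    rcases le_total |u| 1 with h | h
    · have := pow_le_one₀ (n := K+1) (abs_nonneg u) h
      have := pow_nonneg (abs_nonneg u) (K+2)
      linarith
    · have := pow_le_pow_right₀ h (show K+1 ≤ K+2 by omega)
      linarith
  refine ⟨⟨i1, ?_⟩, r2⟩
  have t1 := (Complex.continuous_re.tendsto _).comp h1
  simp only [Function.comp_def, Complex.ofReal_re] at t1
  refine tendsto_nhds_unique (ker_dom μ _ i1) (t1.congr' ?_)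
  filter_upwards [eventually_gt_atTop 0] with y hy using hre y hy

lemma lower_asymp (n : ℕ) (G : ℂ → ℂ) (m : ℕ → ℝ)
    (hlim : Tendsto (fun y : ℝ => (I * y) ^ (n + 1) * (G (I * y)
            - ∑ k ∈ Finset.range n, (m k : ℂ) / (I * y) ^ (k + 1))) atTop (𝓝 (m n:ℂ)))
    (K : ℕ) (hK : K ≤ n) :
    Tendsto (fun y : ℝ => (I * y) ^ (K + 1) * (G (I * y)
            - ∑ k ∈ Finset.range K, (m k : ℂ) / (I * y) ^ (k + 1))) atTop (𝓝 (m K:ℂ)) := by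
  induction hK using Nat.decreasingInduction with
  | self => exact hlim
  | of_succ K hK ih =>
    have h0 : Tendsto (fun y : ℝ => (I * (y:ℂ))⁻¹) atTop (𝓝 0) := by
      apply tendsto_inv₀_cobounded.comp
      rw [← tendsto_norm_atTop_iff_cobounded]
      simpa using tendsto_abs_atTop_atTop
    have := (h0.mul ih).add_const (m K : ℂ)
    rw [zero_mul, zero_add] at this
    refine this.congr' ?_
    filter_upwards [eventually_gt_atTop 0] with y hy
    have hy0 : (y:ℂ) ≠ 0 := by exact_mod_cast hy.ne'
    have : I * (y:ℂ) ≠ 0 := mul_ne_zero I_ne_zero hy0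
    rw [Finset.sum_range_succ, ← sub_sub]
    field_simp
    ring

lemma all_moments (n : ℕ) (μ : Measure ℝ) [IsProbabilityMeasure μ] (m : ℕ → ℝ) (hm0 : m 0 = 1)
    (hlim : Tendsto (fun y : ℝ => (I * y) ^ (2 * n + 1) * (cauchy μ (I * y)
            - ∑ k ∈ Finset.range (2 * n), (m k : ℂ) / (I * y) ^ (k + 1)))
              atTop (𝓝 (m (2 * n):ℂ))) :
    ∀ k ≤ 2 * n, Integrable (fun u => |u| ^ k) μ ∧ mom μ k = m k := by
  have key : ∀ j ≤ n, ∀ k ≤ 2 * j, Integrable (fun u : ℝ => u ^ k) μ ∧ ∫ u, u^k ∂μ = m k := by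
    intro j
    induction j with
    | zero =>
      intro _ k hk
      obtain rfl : k = 0 := by omega
      simp [hm0]
    | succ j ih =>
      intro hj k hk
      have ih := ih (by omega)
      have := mom_step μ m (2*j) (even_two_mul j) (fun k hk => (ih k hk).1)
        (fun k hk => (ih k hk).2) (lower_asymp _ _ m hlim (2*j+1) (by omega))
        (lower_asymp _ _ m hlim (2*j+2) (by omega))
      rcases Nat.lt_or_ge (2*j) k with h | h
      · rcases (show k = 2*j+1 ∨ k = 2*j+2 by omega) with rfl | rfl
        · exact this.1
        · exact this.2
      · exact ih k h
  intro k hk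
  obtain ⟨a, b⟩ := key n le_rfl k hk
  refine ⟨?_, b⟩
  simpa using a.norm
def pk (w : ℂ) (θ : ℝ) : ℝ := (1 - ‖w‖^2) / ‖exp (θ * I) - w‖^2

lemma exp_sub_ne (w : ℂ) (hw : ‖w‖ < 1) (θ : ℝ) : 0 < ‖exp (θ * I) - w‖ := by
  have := norm_sub_norm_le (exp (θ * I)) w
  rw [Complex.norm_exp_ofReal_mul_I] at this
  linarith

lemma pk_cont (w : ℂ) (hw : ‖w‖ < 1) : Continuous (pk w) := by
  unfold pk
  apply Continuous.div continuous_const (by fun_prop)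
  intro θ
  have := exp_sub_ne w hw θ
  positivity

lemma pk_bound (w : ℂ) (hw : ‖w‖ < 1) (θ : ℝ) : ‖pk w θ‖ ≤ (1 - ‖w‖^2) / (1 - ‖w‖)^2 := by
  have h1 := norm_sub_norm_le (exp (θ * I)) w
  rw [Complex.norm_exp_ofReal_mul_I] at h1
  have h2 : 0 ≤ 1 - ‖w‖^2 := by nlinarith [norm_nonneg w]
  unfold pk
  rw [Real.norm_of_nonneg (by positivity)]
  apply div_le_div_of_nonneg_left h2
  · have : 0 < 1 - ‖w‖ := by linarith
    positivity
  · apply pow_le_pow_left₀ _ h1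
    linarith

def pkb (w : ℂ) (hw : ‖w‖ < 1) : BoundedContinuousFunction ℝ ℝ :=
  BoundedContinuousFunction.ofNormedAddCommGroup (pk w) (pk_cont w hw) _ (pk_bound w hw)

lemma poisson_r (f : ℂ → ℂ) (hf : DifferentiableOn ℂ f (Metric.ball 0 1)) (r : ℝ)
    (hr0 : 0 < r) (hr : r < 1) (w : ℂ) (hw : ‖w‖ < 1) :
    ∫ θ in Ioc 0 (2 * Real.pi), ((2 * Real.pi)⁻¹ * (f (r * exp (θ * I))).re) * pk w θ
      = (f (r * w)).re := by
  have hmaps : MapsTo (fun w : ℂ => (r:ℂ) * w) (Metric.closedBall 0 1) (Metric.ball 0 1) := by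
    intro x hx
    simp at hx ⊢
    rw [abs_of_pos hr0]
    nlinarith
  have hd : DifferentiableOn ℂ (fun w => f (r * w)) (Metric.closedBall 0 1) :=
    hf.comp (by fun_prop) hmaps
  have hd' : DiffContOnCl ℂ (fun w => f (r * w)) (Metric.ball 0 1) :=
    DifferentiableOn.diffContOnCl (by rwa [closure_ball _ one_ne_zero])
  have h := hd'.circleAverage_poissonKernel_smul' (w := w) (by simpa using hw)
  have hc : CircleIntegrable (fun z : ℂ =>
      ((‖z - 0‖ ^ 2 - ‖w - 0‖ ^ 2) / ‖z - 0 - (w - 0)‖ ^ 2) • f (r * z)) 0 1 := by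
    apply ContinuousOn.circleIntegrable zero_le_one
    apply ContinuousOn.fun_smul
    · apply ContinuousOn.div (by fun_prop) (by fun_prop)
      intro z hz
      simp at hz
      have := norm_sub_norm_le z w
      have : 0 < ‖z - w‖ := by linarith
      simp only [sub_zero]
      positivity
    · exact hd.continuousOn.mono Metric.sphere_subset_closedBall
  have h2 := reCLM.circleAverage_comp_comm hc
  rw [h] at h2
  simp only [reCLM_apply] at h2
  rw [← h2, Real.circleAverage_def, intervalIntegral.integral_of_le (by positivity), smul_eq_mul,
    ← integral_const_mul]
  apply integral_congr_ae
  refine Eventually.of_forall fun θ => ?_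
  simp only [Function.comp, circleMap, pk, reCLM_apply, Complex.smul_re, smul_eq_mul, zero_add,
    Complex.ofReal_one, one_mul, sub_zero, Complex.norm_exp_ofReal_mul_I, one_pow]
  ring

lemma herglotz_disc (f : ℂ → ℂ) (hf : DifferentiableOn ℂ f (Metric.ball 0 1))
    (h0 : ∀ w : ℂ, ‖w‖ < 1 → 0 ≤ (f w).re) :
    ∃ σ : Measure ℝ, IsFiniteMeasure σ ∧ ∀ w : ℂ, ‖w‖ < 1 → (f w).re = ∫ θ, pk w θ ∂σ := by
  set r : ℕ → ℝ := fun k => 1 - 1 / ((k:ℝ) + 2) with hr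
  have hr0 : ∀ k, 0 < r k := by
    intro k
    simp only [hr, sub_pos]
    rw [div_lt_one (by positivity)]
    have : (0:ℝ) ≤ k := by positivity
    linarith
  have hr1 : ∀ k, r k < 1 := by
    intro k
    simp only [hr]
    have : (0:ℝ) < 1 / ((k:ℝ)+2) := by positivity
    linarith
  have hrt : Tendsto r atTop (𝓝 1) := by
    have : Tendsto (fun k : ℕ => 1 / ((k:ℝ) + 2)) atTop (𝓝 0) := by
      apply Tendsto.div_atTop tendsto_const_nhds
      exact tendsto_atTop_add_const_right _ _ tendsto_natCast_atTop_atTop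
    simpa [hr] using (tendsto_const_nhds (x := (1:ℝ))).sub this
  have hrn : ∀ k (w : ℂ), ‖w‖ ≤ 1 → ‖(r k : ℂ) * w‖ < 1 := by
    intro k w hw
    rw [norm_mul, Complex.norm_real, Real.norm_of_nonneg (hr0 k).le]
    nlinarith [hr0 k, hr1 k, norm_nonneg w]
  set d : ℕ → ℝ → ℝ := fun k θ => (2 * Real.pi)⁻¹ * (f (r k * exp (θ * I))).re with hd
  have hd0 : ∀ k θ, 0 ≤ d k θ := by
    intro k θ
    have := h0 _ (hrn k (exp (θ*I)) (by rw [Complex.norm_exp_ofReal_mul_I]))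
    simp only [hd]
    positivity
  have hdc : ∀ k, Continuous (d k) := by
    intro k
    have : Continuous (fun θ : ℝ => f (r k * exp (θ * I))) := by
      apply hf.continuousOn.comp_continuous (by fun_prop)
      intro θ
      simpa using hrn k (exp (θ*I)) (by rw [Complex.norm_exp_ofReal_mul_I])
    exact continuous_const.mul (continuous_re.comp this)
  set s : ℕ → Measure ℝ := fun k => (volume.restrict (Ioc 0 (2 * Real.pi))).withDensity
    (fun θ => ENNReal.ofReal (d k θ)) with hs
  have hmass : ∀ k, s k univ = ENNReal.ofReal (f 0).re := by
    intro k
    rw [hs, withDensity_apply _ MeasurableSet.univ, Measure.restrict_univ,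
      ← ofReal_integral_eq_lintegral_ofReal]
    · congr 1
      have := poisson_r f hf (r k) (hr0 k) (hr1 k) 0 (by simp)
      simpa [pk, hd, Complex.norm_exp_ofReal_mul_I] using this
    · exact ((hdc k).integrableOn_Icc).mono_set Ioc_subset_Icc_self
    · exact Eventually.of_forall (hd0 k)
  have hfin : ∀ k, IsFiniteMeasure (s k) := fun k => ⟨by rw [hmass k]; exact ENNReal.ofReal_lt_top⟩
  have hint : ∀ k (w : ℂ), ‖w‖ < 1 → ∫ θ, pk w θ ∂(s k) = (f (r k * w)).re := by
    intro k w hw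
    rw [← poisson_r f hf (r k) (hr0 k) (hr1 k) w hw, hs,
      integral_withDensity_eq_integral_toReal_smul
        (hdc k).measurable.ennreal_ofReal
        (Eventually.of_forall fun _ => ENNReal.ofReal_lt_top)]
    apply integral_congr_ae
    refine Eventually.of_forall fun θ => ?_
    simp only [ENNReal.toReal_ofReal (hd0 k θ), smul_eq_mul]
    rfl
  let F : ℕ → FiniteMeasure ℝ := fun k => ⟨s k, hfin k⟩
  have hcomp := isCompact_setOfPred_finiteMeasure_le_of_isCompact (E := ℝ)
    ((f 0).re.toNNReal) (isCompact_Icc (a := (0:ℝ)) (b := 2 * Real.pi))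
  obtain ⟨σ, -, hσ⟩ := hcomp.exists_mapClusterPt (f := atTop) (u := F) (by
    rw [le_principal_iff, mem_map]
    refine Eventually.of_forall fun k => ⟨?_, ?_⟩
    · rw [← ENNReal.coe_le_coe, FiniteMeasure.ennreal_mass]
      exact (hmass k).le
    · rw [← ENNReal.coe_inj, FiniteMeasure.ennreal_coeFn_eq_coeFn_toMeasure]
      show s k _ = 0
      apply withDensity_absolutelyContinuous
      rw [Measure.restrict_apply measurableSet_Icc.compl]
      convert measure_empty (μ := (volume : Measure ℝ))
      rw [← disjoint_iff_inter_eq_empty]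
      exact disjoint_compl_left.mono_right Ioc_subset_Icc_self)
  obtain ⟨U, hU, hUσ⟩ := mapClusterPt_iff_ultrafilter.1 hσ
  refine ⟨σ, inferInstance, fun w hw => ?_⟩
  have t1 := FiniteMeasure.tendsto_iff_forall_integral_tendsto.1 hUσ (pkb w hw)
  have t2 : Tendsto (fun k => (f (r k * w)).re) U (𝓝 (f w).re) := by
    have hcw : ContinuousAt f w := hf.continuousOn.continuousAt
      (Metric.isOpen_ball.mem_nhds (by simpa using hw))
    have : Tendsto (fun k => (r k : ℂ) * w) U (𝓝 w) := by
      have := ((Complex.continuous_ofReal.tendsto 1).comp (hrt.mono_left hU)).mul_const w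
      simpa [Function.comp_def] using this
    exact (Complex.continuous_re.tendsto _).comp (hcw.tendsto.comp this)
  refine tendsto_nhds_unique t2 (t1.congr fun k => ?_)
  exact hint k w hw
def uu (θ : ℝ) : ℝ := -Real.sin θ / (1 - Real.cos θ)

lemma zI_ne (z : ℂ) (hz : 0 < z.im) : z + I ≠ 0 := by
  intro h
  have := congrArg Complex.im h
  simp at this
  linarith

lemma cay_norm (z : ℂ) (hz : 0 < z.im) : ‖(z - I)/(z + I)‖ < 1 := by
  have h1 := norm_pos_iff.2 (zI_ne z hz)
  rw [norm_div, div_lt_one h1]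
  apply lt_of_pow_lt_pow_left₀ 2 (norm_nonneg _)
  rw [← normSq_eq_norm_sq, ← normSq_eq_norm_sq, normSq_apply, normSq_apply]
  simp
  nlinarith

lemma pk_cay (z : ℂ) (hz : 0 < z.im) (θ : ℝ) :
    pk ((z - I)/(z + I)) θ = 4 * z.im / normSq (exp (θ * I) * (z + I) - (z - I)) := by
  have h0 := zI_ne z hz
  have h1 : normSq (z + I) ≠ 0 := by simpa using h0
  have h2 : exp (θ * I) - (z - I)/(z + I) = (exp (θ * I) * (z + I) - (z - I)) / (z + I) := by
    field_simp
  unfold pk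
  rw [h2, ← normSq_eq_norm_sq, ← normSq_eq_norm_sq, normSq_div, normSq_div]
  rw [one_sub_div h1, div_div_div_cancel_right₀ h1]
  congr 1
  simp [normSq_apply]
  ring

lemma exp_re_im (θ : ℝ) : exp (θ * I) = ⟨Real.cos θ, Real.sin θ⟩ := by
  apply Complex.ext
  · exact Complex.exp_ofReal_mul_I_re θ
  · exact Complex.exp_ofReal_mul_I_im θ

lemma pk_one (z : ℂ) (hz : 0 < z.im) (θ : ℝ) (h : Real.cos θ = 1) :
    pk ((z - I)/(z + I)) θ = z.im := by
  have hs : Real.sin θ = 0 := by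
    have := Real.sin_sq_add_cos_sq θ
    rw [h] at this
    nlinarith
  rw [pk_cay z hz, exp_re_im, h, hs, normSq_apply]
  simp
  field_simp
  norm_num

lemma pk_ne (z : ℂ) (hz : 0 < z.im) (θ : ℝ) (h : Real.cos θ ≠ 1) :
    pk ((z - I)/(z + I)) θ = z.im * (1 + (uu θ)^2) / normSq (z - uu θ) := by
  have ha : 1 - Real.cos θ ≠ 0 := sub_ne_zero.2 (Ne.symm h)
  have hb : Real.sin θ = -(uu θ * (1 - Real.cos θ)) := by
    unfold uu; field_simp
  have hsq := Real.sin_sq_add_cos_sq θ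
  have hu : (uu θ)^2 * (1 - Real.cos θ) = 1 + Real.cos θ := by
    apply mul_right_cancel₀ ha
    rw [hb] at hsq
    linear_combination hsq
  have hN : normSq (exp (θ * I) * (z + I) - (z - I)) =
      2 * (1 - Real.cos θ) * normSq (z - uu θ) := by
    rw [exp_re_im, normSq_apply, normSq_apply]
    simp only [mul_re, mul_im, sub_re, sub_im, add_re, add_im, I_re, I_im, ofReal_re, ofReal_im]
    rw [hb]
    set a := Real.cos θ
    set u := uu θ
    linear_combination (z.re^2 * (1-a) + (z.im+1)^2 * (1-a) - 2 * (1-a) - 2 * a) * hu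
  have h1 : normSq (z - uu θ) ≠ 0 := by simpa using zsub_ne z hz (uu θ)
  rw [pk_cay z hz, hN, div_eq_div_iff (by positivity) h1]
  linear_combination (-2 * z.im * normSq (z - uu θ)) * hu

lemma rep (G : ℂ → ℂ) (hG : DifferentiableOn ℂ G {z : ℂ | 0 < z.im})
    (hIm : ∀ z : ℂ, 0 < z.im → (G z).im ≤ 0) :
    ∃ (c : ℝ) (τ : Measure ℝ), 0 ≤ c ∧ IsFiniteMeasure τ ∧ ∀ z : ℂ, 0 < z.im →
      -(G z).im = c * z.im + ∫ u : ℝ, z.im * (1 + u^2) / normSq (z - u) ∂τ := by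
  have hmap : ∀ w : ℂ, ‖w‖ < 1 → 1 - w ≠ 0 ∧ 0 < (I * (1 + w) / (1 - w)).im := by
    intro w hw
    have h1 : 1 - w ≠ 0 := by
      intro h
      rw [sub_eq_zero] at h
      rw [← h] at hw
      simp at hw
    refine ⟨h1, ?_⟩
    have h2 : 0 < normSq (1 - w) := normSq_pos.2 h1
    have h3 : w.re^2 + w.im^2 < 1 := by
      have := normSq_eq_norm_sq w
      rw [normSq_apply] at this
      nlinarith [norm_nonneg w]
    rw [Complex.div_im]
    simp only [mul_re, mul_im, sub_re, sub_im, add_re, add_im, I_re, I_im, one_re, one_im]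
    rw [← sub_div]
    apply div_pos _ h2
    nlinarith
  obtain ⟨σ, hσ, hrep⟩ := herglotz_disc (fun w => I * G (I * (1 + w) / (1 - w))) (by
    apply DifferentiableOn.const_mul
    apply hG.comp
    · apply DifferentiableOn.div (by fun_prop) (by fun_prop)
      intro w hw
      exact (hmap w (by simpa using hw)).1
    · intro w hw
      exact (hmap w (by simpa using hw)).2) (by
    intro w hw
    have := hIm _ (hmap w hw).2
    simpa using this)
  have hA : MeasurableSet {θ : ℝ | Real.cos θ = 1} :=
    measurableSet_eq_fun (by fun_prop) (by fun_prop)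
  set A := {θ : ℝ | Real.cos θ = 1} with hAdef
  have huu : Measurable uu := by unfold uu; fun_prop
  refine ⟨σ.real A, (σ.restrict Aᶜ).map uu, measureReal_nonneg, inferInstance, fun z hz => ?_⟩
  have hn := cay_norm z hz
  have e := hrep _ hn
  have h0 := zI_ne z hz
  have hz' : I * (1 + (z - I)/(z + I)) / (1 - (z - I)/(z + I)) = z := by
    have h1 := (hmap _ hn).1
    rw [div_eq_iff h1]
    field_simp
    ring_nf
  rw [hz'] at e
  have hpi : Integrable (pk ((z - I)/(z + I))) σ :=
    Integrable.of_bound (pk_cont _ hn).measurable.aestronglyMeasurable _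
      (Eventually.of_forall (pk_bound _ hn))
  rw [← integral_add_compl hA hpi] at e
  have e1 : ∫ θ in A, pk ((z - I)/(z + I)) θ ∂σ = σ.real A * z.im := by
    rw [setIntegral_congr_fun hA (g := fun _ => z.im) (fun θ hθ => pk_one z hz θ hθ)]
    simp
  have e2 : ∫ θ in Aᶜ, pk ((z - I)/(z + I)) θ ∂σ =
      ∫ u : ℝ, z.im * (1 + u^2) / normSq (z - u) ∂((σ.restrict Aᶜ).map uu) := by
    rw [setIntegral_congr_fun hA.compl (fun θ hθ => pk_ne z hz θ hθ)]
    rw [integral_map huu.aemeasurable]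
    apply Measurable.aestronglyMeasurable
    have : Measurable (fun u : ℝ => normSq (z - u)) :=
      (continuous_normSq.comp (by fun_prop)).measurable
    fun_prop
  rw [e1, e2] at e
  rw [← e]
  simp
lemma cauchy_diff (μ : Measure ℝ) [IsFiniteMeasure μ] (z : ℂ) (hz : 0 < z.im) :
    DifferentiableAt ℂ (cauchy μ) z := by
  have h := (hasDerivAt_resolventTransform (μ := μ) z (by
    rintro ⟨u, -, hu⟩
    apply zsub_ne z hz u
    rw [← hu]
    simp)).differentiableAt.neg
  have e : cauchy μ = -resolventTransform μ := by
    funext w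
    rw [Pi.neg_apply, resolventTransform_apply, ← integral_neg]
    unfold cauchy
    congr 1
    funext u
    rw [resolvent, Ring.inverse_eq_inv', ← inv_neg]
    simp
  rw [e]
  exact h

lemma inv_im (z : ℂ) (u : ℝ) : ((z - (u:ℂ))⁻¹).im = -(z.im / normSq (z - u)) := by
  rw [Complex.inv_im]
  simp
  ring

lemma cauchy_im (μ : Measure ℝ) [IsFiniteMeasure μ] (z : ℂ) (hz : 0 < z.im) :
    -(cauchy μ z).im = ∫ u : ℝ, z.im / normSq (z - u) ∂μ := by
  have := integral_im (integrable_inv μ z hz)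
  simp only [RCLike.im_eq_complex_im] at this
  rw [cauchy, ← this, ← integral_neg]
  congr 1
  funext u
  rw [inv_im, neg_neg]

lemma exists_meas (G : ℂ → ℂ) (hG : DifferentiableOn ℂ G {z : ℂ | 0 < z.im})
    (hIm : ∀ z : ℂ, 0 < z.im → (G z).im ≤ 0)
    (hl : Tendsto (fun y : ℝ => (I * y) * G (I * y)) atTop (𝓝 1)) :
    ∃ μ : Measure ℝ, IsProbabilityMeasure μ ∧ ∀ z : ℂ, 0 < z.im → G z = cauchy μ z := by
  obtain ⟨c, τ, hc, hτ, hrep⟩ := rep G hG hIm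
  set J : ℝ → ℝ := fun y => ∫ u : ℝ, y^2/(y^2+u^2) * (1 + u^2) ∂τ with hJ
  have hJ0 : ∀ y, 0 ≤ J y := fun y => integral_nonneg fun u => by positivity
  have ht : Tendsto (fun y : ℝ => c * y^2 + J y) atTop (𝓝 1) := by
    have := (Complex.continuous_re.tendsto _).comp hl
    simp only [Function.comp_def, Complex.one_re] at this
    refine this.congr' ?_
    filter_upwards [eventually_gt_atTop 0] with y hy
    have e := hrep (I * y) (by simpa using hy)
    have e3 : ((I * y) * G (I*y)).re = y * (-(G (I*y)).im) := by simp
    rw [e3, e, mul_add, ← integral_const_mul, hJ]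
    congr 1
    · simp; ring
    · congr 1
      funext u
      have : normSq (I * y - u) = y^2 + u^2 := by simp [normSq_apply]; ring
      rw [this]
      simp
      ring
  have hc0 : c = 0 := by
    by_contra hne
    have hpos : 0 < c := lt_of_le_of_ne hc (Ne.symm hne)
    refine not_tendsto_nhds_of_tendsto_atTop ?_ _ ht
    exact tendsto_atTop_mono (fun y => le_add_of_nonneg_right (hJ0 y))
      ((tendsto_pow_atTop two_ne_zero).const_mul_atTop hpos)
  subst hc0
  simp only [zero_mul, zero_add] at ht hrep
  obtain ⟨hi, hi1⟩ := ker_fatou τ (fun u => 1 + u^2) (fun u => by positivity) (by fun_prop) (by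
    intro y hy
    refine Integrable.of_bound (C := 1 + y^2) ?_ ?_
    · apply Measurable.aestronglyMeasurable; fun_prop
    · refine Eventually.of_forall fun u => ?_
      rw [Real.norm_of_nonneg (by positivity), div_mul_eq_mul_div, div_le_iff₀ (by positivity)]
      nlinarith [sq_nonneg (y*u), sq_nonneg (y^2), sq_nonneg u]) 1 ht
  set μ := τ.withDensity (fun u => ENNReal.ofReal (1 + u^2)) with hμ
  have hp : IsProbabilityMeasure μ := ⟨by
    rw [hμ, withDensity_apply _ MeasurableSet.univ, Measure.restrict_univ,
      ← ofReal_integral_eq_lintegral_ofReal hi (Eventually.of_forall fun u => by positivity), hi1]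
    simp⟩
  refine ⟨μ, hp, ?_⟩
  have him : ∀ z : ℂ, 0 < z.im → (G z).im = (cauchy μ z).im := by
    intro z hz
    rw [← neg_inj, hrep z hz, cauchy_im μ z hz, hμ,
      integral_withDensity_eq_integral_toReal_smul (by fun_prop)
        (Eventually.of_forall fun _ => ENNReal.ofReal_lt_top)]
    congr 1
    funext u
    rw [ENNReal.toReal_ofReal (by positivity), smul_eq_mul]
    ring
  have hopen : IsOpen {z : ℂ | 0 < z.im} := isOpen_lt continuous_const Complex.continuous_im
  have hconv : Convex ℝ {z : ℂ | 0 < z.im} := convex_halfSpace_im_gt 0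
  have hd : DifferentiableOn ℂ (fun z => G z - cauchy μ z) {z : ℂ | 0 < z.im} :=
    hG.sub fun z hz => (cauchy_diff μ z hz).differentiableWithinAt
  obtain ⟨C, hC⟩ := AnalyticOnNhd.eq_const_of_im_eq_const (c₀ := 0) (hd.analyticOnNhd hopen)
    (fun z hz => by simp [him z hz]) hopen
    ⟨⟨I, by simp⟩, hconv.isPreconnected⟩
  have hz0 : Tendsto (fun y : ℝ => G (I*y) - cauchy μ (I*y)) atTop (𝓝 0) := by
    have h0 : Tendsto (fun y : ℝ => (I * (y:ℂ))⁻¹) atTop (𝓝 0) := by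
      apply tendsto_inv₀_cobounded.comp
      rw [← tendsto_norm_atTop_iff_cobounded]
      simpa using tendsto_abs_atTop_atTop
    have g0 : Tendsto (fun y : ℝ => G (I*y)) atTop (𝓝 0) := by
      have := h0.mul hl
      rw [zero_mul] at this
      refine this.congr' ?_
      filter_upwards [eventually_gt_atTop 0] with y hy
      have hy0 : (y:ℂ) ≠ 0 := by exact_mod_cast hy.ne'
      have : I * (y:ℂ) ≠ 0 := mul_ne_zero I_ne_zero hy0
      field_simp
    have c0 : Tendsto (fun y : ℝ => cauchy μ (I*y)) atTop (𝓝 0) := by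
      refine squeeze_zero_norm' ?_ tendsto_inv_atTop_zero
      filter_upwards [eventually_gt_atTop 0] with y hy
      have hz : 0 < (I*(y:ℂ)).im := by simpa using hy
      have := norm_integral_le_of_norm_le_const (μ := μ)
        (Eventually.of_forall (norm_inv_le _ hz))
      simpa [cauchy] using this
    simpa using g0.sub c0
  have hC0 : C = 0 := by
    refine tendsto_nhds_unique (tendsto_const_nhds.congr' ?_) hz0
    filter_upwards [eventually_gt_atTop 0] with y hy
    exact (hC (I*y) (by simpa using hy)).symm
  intro z hz
  have := hC z hz
  rw [hC0] at this
  exact sub_eq_zero.1 this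

theorem stmt_6
    (n : ℕ) (hn : 1 ≤ n) (G : ℂ → ℂ)
    (hG : DifferentiableOn ℂ G {z : ℂ | 0 < z.im})
    (hIm : ∀ z : ℂ, 0 < z.im → (G z).im ≤ 0)
    (m : ℕ → ℝ) (hm0 : m 0 = 1)
    (hlim : Tendsto (fun y : ℝ =>
        (Complex.I * y) ^ (2 * n + 1) *
          (G (Complex.I * y)
            - ∑ k ∈ Finset.range (2 * n), (m k : ℂ) / (Complex.I * y) ^ (k + 1)))
      atTop (𝓝 ((m (2 * n) : ℂ)))) :
    ∃ μ : Measure ℝ, IsProbabilityMeasure μ ∧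
      (∀ k ≤ 2 * n, Integrable (fun u => |u| ^ k) μ ∧ mom μ k = m k) ∧
      ∀ z : ℂ, 0 < z.im → G z = cauchy μ z := by
  obtain ⟨μ, hμ, hrep⟩ := exists_meas G hG hIm (by
    simpa [hm0] using lower_asymp (2 * n) G m hlim 0 (by omega))
  refine ⟨μ, hμ, all_moments n μ m hm0 (hlim.congr' ?_), hrep⟩
  filter_upwards [eventually_gt_atTop 0] with y hy
  rw [hrep (I * y) (by simpa using hy)]

end FreeCLT
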